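/- Let L be a field, let x ∈ L^n have pairwise distinct entries and y ∈ L^n have all entries nonzero, let 1 ≤ r ≤ n, and let V_r(x,y) be the r × n matrix over L with (a,i)-entry y_i x_i^a for 0 ≤ a ≤ r-1. Set t = ⌊r/2⌋. If v_1, v_2 ∈ L^n each have Hamming weight at most t and V_r(x,y) v_1^⊤ = V_r(x,y) v_2^⊤, then v_1 = v_2. (Syndromes of error vectors of weight up to the error-correction capacity are distinct.) -/

import Mathlib

open Polynomial in
/-- A weighted sum over `s` whose first `#s` power moments at distinct nodes vanish has
zero weights. -/
theorem Finset.eq_zero_of_sum_mul_pow_eq_zero {ι R : Type*} [CommRing R] [IsDomain R]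
    {s : Finset ι} {x w : ι → R} (hx : Set.InjOn x s)
    (h : ∀ a < s.card, ∑ i ∈ s, w i * x i ^ a = 0) {i : ι} (hi : i ∈ s) : w i = 0 := by
  classical
  set p : R[X] := ∏ j ∈ s.erase i, (X - C (x j)) with hp
  have hdeg : p.natDegree < s.card := by
    rw [hp, natDegree_finsetProd_X_sub_C_eq_card]
    exact Finset.card_erase_lt_of_mem hi
  have hsum : ∑ k ∈ s, w k * p.eval (x k) = 0 := by
    simp_rw [eval_eq_sum_range' hdeg, Finset.mul_sum]
    rw [Finset.sum_comm]
    refine Finset.sum_eq_zero fun a ha => ?_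
    simp_rw [mul_left_comm (w _), ← Finset.mul_sum]
    rw [h a (Finset.mem_range.mp ha), mul_zero]
  have heval (k : ι) : p.eval (x k) = ∏ j ∈ s.erase i, (x k - x j) := by
    simp [hp, eval_prod]
  rw [Finset.sum_eq_single_of_mem i hi] at hsum
  · refine (mul_eq_zero.mp hsum).resolve_right ?_
    rw [heval, ← ne_eq, Finset.prod_ne_zero_iff]
    intro j hj
    obtain ⟨hji, hjs⟩ := Finset.mem_erase.mp hj
    exact sub_ne_zero.mpr fun hij => hji (hx hjs hi hij.symm)
  · intro k hk hki
    rw [heval, Finset.prod_eq_zero (Finset.mem_erase.mpr ⟨hki, hk⟩) (sub_self _), mul_zero]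



/-- Syndromes (w.r.t. the GRS parity check matrix `V_r(x,y)`) of error
vectors of Hamming weight at most `t = ⌊r/2⌋` are distinct. -/
theorem GRS_syndromes_injective {L : Type} [Field L] (n r : ℕ) (hr1 : 1 ≤ r) (hrn : r ≤ n)
    (x y : Fin n → L) (hx : Function.Injective x) (hy : ∀ i, y i ≠ 0)
    (V : Matrix (Fin r) (Fin n) L)
    (hV : ∀ (a : Fin r) (i : Fin n), V a i = y i * x i ^ (a : ℕ))
    (t : ℕ) (ht : t = r / 2) :
    ∀ v₁ v₂ : Fin n → L, {i | v₁ i ≠ 0}.ncard ≤ t → {i | v₂ i ≠ 0}.ncard ≤ t →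
      V.mulVec v₁ = V.mulVec v₂ → v₁ = v₂ := by
  classical
  intro v₁ v₂ h₁ h₂ hv
  set s : Finset (Fin n) := Finset.univ.filter (fun i => v₁ i ≠ v₂ i) with hs
  have hcard : s.card ≤ r := by
    have hsub : (s : Set (Fin n)) ⊆ {i | v₁ i ≠ 0} ∪ {i | v₂ i ≠ 0} := by
      intro i hi
      simp only [hs, Finset.coe_filter, Finset.mem_univ, true_and, Set.mem_ofPred_eq] at hi
      by_contra hc
      simp_all
    have hle := (Set.ncard_le_ncard hsub (Set.toFinite _)).trans (Set.ncard_union_le _ _)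
    rw [Set.ncard_coe_finset] at hle
    omega
  have hmoment : ∀ a < s.card, ∑ i ∈ s, y i * (v₁ i - v₂ i) * x i ^ a = 0 := by
    intro a ha
    have hva := congrFun hv ⟨a, ha.trans_le hcard⟩
    simp only [Matrix.mulVec, dotProduct, hV] at hva
    rw [hs, Finset.sum_filter_of_ne, ← sub_eq_zero.mpr hva, ← Finset.sum_sub_distrib]
    · exact Finset.sum_congr rfl fun i _ => by ring
    · intro i _ hi heq
      simp [heq] at hi
  funext i
  by_contra hi
  have hzero := Finset.eq_zero_of_sum_mul_pow_eq_zero hx.injOn hmoment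
    (Finset.mem_filter.mpr ⟨Finset.mem_univ i, hi⟩)
  exact mul_ne_zero (hy i) (sub_ne_zero.mpr hi) hzero
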